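/- arXiv:2108.07024 — 2 statements merged into one kernel-verified Lean document; each statement's English description precedes it below -/
import Mathlib

section
/- Let 0 < a < 1, r = (1−a²)/2, A the explicit 5×5 matrix of Proposition 4.1 (with ω = 0), and X = A − aI. Then for every θ ∈ ℝ, the characteristic polynomial of Re(e^{iθ}X) equals −(λ² − r²)(λ³ + √(1−2r) cos θ · λ² + (r² − 2r)λ + r²√(1−2r) cos θ) up to sign convention; in particular λ² − r² divides the Kippenhahn polynomial of X for all θ. -/
open Matrix Polynomial

set_option maxHeartbeats 4000000 in
lemma det_aux (a s E F x c : ℂ) (hs : s ^ 2 = 1 - a ^ 2) (hEF : F * E = 1 / 4) (hc : E + F = c) :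
    Matrix.det !![x + a * (E + F), -(E * s), -(E * (a * s)), -(E * (a ^ 2 * s)), -(E * (a ^ 3 * s));
      -(F * s), x, E * (1 - a ^ 2), E * (a * (1 - a ^ 2)), E * (a ^ 2 * (1 - a ^ 2));
      -(F * (a * s)), F * (1 - a ^ 2), x, E * (1 - a ^ 2), E * (a * (1 - a ^ 2));
      -(F * (a ^ 2 * s)), F * (a * (1 - a ^ 2)), F * (1 - a ^ 2), x, E * (1 - a ^ 2);
      -(F * (a ^ 3 * s)), F * (a ^ 2 * (1 - a ^ 2)), F * (a * (1 - a ^ 2)), F * (1 - a ^ 2), x]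
    = (x ^ 2 - ((1 - a ^ 2) / 2) ^ 2) * (x ^ 3 + a * c * x ^ 2
        + (((1 - a ^ 2) / 2) ^ 2 - 2 * ((1 - a ^ 2) / 2)) * x
        + ((1 - a ^ 2) / 2) ^ 2 * (a * c)) := by
  have hE : E ≠ 0 := by
    rintro rfl
    norm_num at hEF
  have hF : F = 1 / (4 * E) := by
    field_simp
    linear_combination 4 * hEF
  subst hc
  simp [Matrix.det_succ_row_zero, Fin.sum_univ_succ, Fin.succAbove, Matrix.submatrix]
  ring_nf
  simp only [hs]
  subst hF
  field_simp
  ring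

theorem c45_kippenhahn_factorization
    (a r : ℝ) (ha : 0 < a) (ha1 : a < 1) (hr : r = (1 - a ^ 2) / 2)
    (A : Matrix (Fin 5) (Fin 5) ℂ)
    (hA : A = !![(0 : ℂ), Real.sqrt (1 - a ^ 2), a * Real.sqrt (1 - a ^ 2),
                  a ^ 2 * Real.sqrt (1 - a ^ 2), a ^ 3 * Real.sqrt (1 - a ^ 2);
                 0, a, a ^ 2 - 1, a * (a ^ 2 - 1), a ^ 2 * (a ^ 2 - 1);
                 0, 0, (a : ℂ), a ^ 2 - 1, a * (a ^ 2 - 1);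
                 0, 0, 0, (a : ℂ), a ^ 2 - 1;
                 0, 0, 0, 0, (a : ℂ)])
    (X : Matrix (Fin 5) (Fin 5) ℂ) (hX : X = A - (a : ℂ) • 1) :
    ∀ θ : ℝ,
      ((1 / 2 : ℂ) • (Complex.exp (θ * Complex.I) • X
          + Complex.exp (-(θ * Complex.I)) • Xᴴ)).charpoly
        = (Polynomial.X ^ 2 - Polynomial.C ((r : ℂ) ^ 2)) *
          (Polynomial.X ^ 3
            + Polynomial.C ((Real.sqrt (1 - 2 * r) * Real.cos θ : ℝ) : ℂ) * Polynomial.X ^ 2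
            + Polynomial.C (((r ^ 2 - 2 * r : ℝ)) : ℂ) * Polynomial.X
            + Polynomial.C ((r ^ 2 * (Real.sqrt (1 - 2 * r) * Real.cos θ) : ℝ) : ℂ)) ∧
      (Polynomial.X ^ 2 - Polynomial.C ((r : ℂ) ^ 2)) ∣
        ((1 / 2 : ℂ) • (Complex.exp (θ * Complex.I) • X
          + Complex.exp (-(θ * Complex.I)) • Xᴴ)).charpoly := by
  intro θ
  have key : ((1 / 2 : ℂ) • (Complex.exp (θ * Complex.I) • X
          + Complex.exp (-(θ * Complex.I)) • Xᴴ)).charpoly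
        = (Polynomial.X ^ 2 - Polynomial.C ((r : ℂ) ^ 2)) *
          (Polynomial.X ^ 3
            + Polynomial.C ((Real.sqrt (1 - 2 * r) * Real.cos θ : ℝ) : ℂ) * Polynomial.X ^ 2
            + Polynomial.C (((r ^ 2 - 2 * r : ℝ)) : ℂ) * Polynomial.X
            + Polynomial.C ((r ^ 2 * (Real.sqrt (1 - 2 * r) * Real.cos θ) : ℝ) : ℂ)) := by
    have hsq : Real.sqrt (1 - 2 * r) = a := by
      rw [hr, show 1 - 2 * ((1 - a ^ 2) / 2) = a ^ 2 by ring]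
      exact Real.sqrt_sq ha.le
    have hs0 : (Real.sqrt (1 - a ^ 2)) ^ 2 = 1 - a ^ 2 := Real.sq_sqrt (by nlinarith)
    have hs : ((Real.sqrt (1 - a ^ 2) : ℝ) : ℂ) ^ 2 = 1 - (a : ℂ) ^ 2 := by
      exact_mod_cast congrArg (fun t : ℝ => (t : ℂ)) hs0
    rw [hsq]
    apply Polynomial.funext
    intro x
    rw [Matrix.eval_charpoly]
    have hEF : (Complex.exp (-(θ * Complex.I)) / 2) * (Complex.exp (θ * Complex.I) / 2) = 1 / 4 := by
      have h : Complex.exp (-(θ * Complex.I)) * Complex.exp (θ * Complex.I) = 1 := by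
        rw [← Complex.exp_add]; simp
      linear_combination h / 4
    have hc : Complex.exp (θ * Complex.I) / 2 + Complex.exp (-(θ * Complex.I)) / 2
        = ((Real.cos θ : ℝ) : ℂ) := by
      rw [Complex.ofReal_cos, Complex.cos, neg_mul]; ring
    have h := det_aux (a : ℂ) _ _ _ x _ hs hEF hc
    subst hr
    refine Eq.trans (congrArg Matrix.det ?_) (h.trans ?_)
    · subst hX hA
      generalize Complex.exp (θ * Complex.I) = E
      generalize Complex.exp (-(θ * Complex.I)) = F
      ext i j
      fin_cases i <;> fin_cases j <;>
        simp [Matrix.scalar_apply, Matrix.conjTranspose_apply, Matrix.one_apply] <;> ring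
    · simp
  exact ⟨key, by rw [key]; exact Dvd.intro _ rfl⟩
end

section
/- GWW conjecture for n = 5: if A is a 5×5 complex matrix that is a partial isometry (AᴴA is an orthogonal projection) and its numerical range W(A) is a closed circular disk {z : |z − c| ≤ r} with r > 0, then c = 0. -/
open Matrix

section
open Polynomial
theorem aux_derivative_det {n : Type*} [Fintype n] [DecidableEq n] {R : Type*} [CommRing R]
    (M : Matrix n n R[X]) :
    derivative M.det = trace (adjugate M * M.map derivative) := by
  have h1 : trace (adjugate M * M.map derivative)
      = ∑ i, (M.updateCol i (fun k => derivative (M k i))).det := by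
    unfold trace
    refine Finset.sum_congr rfl fun i _ => ?_
    rw [← cramer_apply, cramer_eq_adjugate_mulVec]
    simp [Matrix.mul_apply, mulVec, dotProduct]
  rw [h1]
  simp only [det_apply]
  rw [Finset.sum_comm, derivative_sum]
  refine Finset.sum_congr rfl fun σ _ => ?_
  rw [← Finset.smul_sum, Units.smul_def, derivative_smul, derivative_prod_finset]
  rw [Units.smul_def]
  congr 1
  refine Finset.sum_congr rfl fun i _ => ?_
  rw [← Finset.mul_prod_erase Finset.univ _ (Finset.mem_univ i), mul_comm]
  congr 1
  · simp
  · refine Finset.prod_congr rfl fun j hj => ?_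
    rw [updateCol_ne (Finset.ne_of_mem_erase hj)]

theorem aux_det_expand {n : Type*} [Fintype n] [DecidableEq n] {R : Type*} [CommRing R]
    (Y B : Matrix n n R) (e : R) :
    ∃ q, (Y + e • B).det = Y.det + e * trace (adjugate Y * B) + e ^ 2 * q := by
  set M : Matrix n n R[X] := Y.map C + (X : R[X]) • B.map C with hM
  have hev : ∀ a : R, (evalRingHom a).mapMatrix M = Y + a • B := by
    intro a
    ext i j
    simp [hM]
    exact mul_comm _ _
  have hp : ∀ a : R, M.det.eval a = (Y + a • B).det := by
    intro a
    rw [← hev a, ← coe_evalRingHom, RingHom.map_det]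
  have hd : M.map derivative = B.map C := by
    ext i j : 2
    simp [hM]
  have h1 : M.det.coeff 1 = trace (adjugate Y * B) := by
    have : (derivative M.det).coeff 0 = M.det.coeff 1 := by
      rw [coeff_derivative]; simp
    rw [← this, aux_derivative_det, hd, coeff_zero_eq_eval_zero, ← coe_evalRingHom,
      AddMonoidHom.map_trace, ← RingHom.mapMatrix_apply]
    have h2 := hev 0
    rw [map_mul, RingHom.map_adjugate, h2]
    simp
    congr 2
    ext i j
    simp
  have h0 : M.det.coeff 0 = Y.det := by
    rw [coeff_zero_eq_eval_zero, hp]; simp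
  refine ⟨M.det.divX.divX.eval e, ?_⟩
  rw [← hp]
  conv_lhs => rw [← divX_mul_X_add M.det, ← divX_mul_X_add M.det.divX]
  simp only [eval_add, eval_mul, eval_X, eval_C, coeff_divX, h0, h1]
  ring

/-- the structural identity -/
theorem aux_struct {n : ℕ} (A : Matrix (Fin n) (Fin n) ℂ) (hA : A * Aᴴ * A = A) (c : ℂ) :
    ∃ u v : ℂ[X],
    (C c + X) ^ 2 * trace (adjugate (A.map C - (C c + X : ℂ[X]) • 1) * (Aᴴ.map C - C c • 1))
      = (A.map C - (C c + X : ℂ[X]) • 1).det * u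
        + derivative (A.map C - (C c + X : ℂ[X]) • 1).det * v := by
  set x : ℂ[X] := C c + X with hx
  set AA : Matrix (Fin n) (Fin n) ℂ[X] := A.map C with hAA
  set BB : Matrix (Fin n) (Fin n) ℂ[X] := Aᴴ.map C with hBB
  set Y := AA - x • 1 with hY
  have hABA : AA * BB * AA = AA := by
    have := congrArg (fun M : Matrix (Fin n) (Fin n) ℂ => (C : ℂ →+* ℂ[X]).mapMatrix M) hA
    simpa [hAA, hBB] using this
  set S := adjugate Y with hS
  set f := Y.det with hf
  have hYS : AA * S = x • S + f • 1 := by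
    have : Y * S = f • 1 := mul_adjugate Y
    rw [← this, hY, Matrix.sub_mul]; simp
  have hSY : S * AA = x • S + f • 1 := by
    have : S * Y = f • 1 := adjugate_mul Y
    rw [← this, hY, Matrix.mul_sub]; simp
  have hder : trace S = - derivative f := by
    rw [hf, aux_derivative_det]
    have : Y.map derivative = -1 := by
      ext i j : 2
      by_cases h : i = j
      · subst h; simp [hY, hAA, hx]
      · simp [hY, hAA, hx, h]
    rw [this]; simp [hS]
  have hP : x * trace (S * (1 - BB * AA)) = - f * trace (1 - BB * AA) := by
    have h1 : S * AA * (1 - BB * AA) = 0 := by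
      rw [Matrix.mul_assoc, Matrix.mul_sub, ← Matrix.mul_assoc AA BB AA, hABA]; simp
    rw [hSY, Matrix.add_mul] at h1
    have h2 := congrArg trace h1
    simp only [trace_add, smul_mul, trace_smul, one_mul, trace_zero, smul_eq_mul] at h2
    linear_combination h2
  have hB : x * trace (S * BB) = trace S - trace (S * (1 - BB * AA)) - f * trace BB := by
    have h1 : trace ((AA * S) * BB) = trace (S * (BB * AA)) := by
      rw [Matrix.mul_assoc, trace_mul_comm, Matrix.mul_assoc]
    rw [hYS, Matrix.add_mul] at h1
    simp only [trace_add, smul_mul, trace_smul, one_mul, smul_eq_mul] at h1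
    rw [Matrix.mul_sub, trace_sub, mul_one]
    linear_combination h1
  refine ⟨trace (1 - BB * AA) - x * trace BB, - x + x ^ 2 * C c, ?_⟩
  rw [Matrix.mul_sub, trace_sub, Matrix.mul_smul, trace_smul, mul_one, smul_eq_mul, hder]
  rw [hder] at hB
  linear_combination x * hB - hP

theorem aux_dvd_step (f F q u v : ℂ[X]) (c k : ℂ) (hc : c ≠ 0)
    (h1 : (C c + X) ^ 2 * F = f * u + derivative f * v)
    (h2 : f + C k * X ^ 2 * F + X ^ 4 * q = 0) : X ^ 4 ∣ f := by
  have hcop : ∀ n : ℕ, IsCoprime ((X : ℂ[X]) ^ n) ((C c + X) ^ 2) := by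
    intro n
    apply IsCoprime.pow
    refine ⟨- C c⁻¹, C c⁻¹, ?_⟩
    have : C c⁻¹ * C c = (1 : ℂ[X]) := by rw [← C_mul, inv_mul_cancel₀ hc, C_1]
    linear_combination this
  have step : ∀ n : ℕ, X ^ (n + 1) ∣ f → X ^ n ∣ F := by
    rintro n ⟨g, hg⟩
    refine (hcop n).dvd_of_dvd_mul_left ?_
    rw [h1, hg]
    refine ⟨X * g * u + (C ((n : ℂ) + 1) * g + X * derivative g) * v, ?_⟩
    have hd : derivative (X ^ (n + 1) : ℂ[X]) = C ((n : ℂ) + 1) * X ^ n := by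
      rw [derivative_X_pow]; simp
    rw [derivative_mul, hd]
    ring
  have a2 : X ^ 2 ∣ f := ⟨- C k * F - X ^ 2 * q, by linear_combination h2⟩
  obtain ⟨F1, hF1⟩ := step 1 a2
  have a3 : X ^ 3 ∣ f := ⟨- C k * F1 - X * q, by rw [hF1] at h2; linear_combination h2⟩
  obtain ⟨F2, hF2⟩ := step 2 a3
  exact ⟨- C k * F2 - q, by rw [hF2] at h2; linear_combination h2⟩

end

theorem aux_unitary_col {n : ℕ} (v : Fin (n+1) → ℂ) (hv : v ≠ 0) :
    ∃ U : Matrix (Fin (n+1)) (Fin (n+1)) ℂ, Uᴴ * U = 1 ∧ ∃ k : ℂ, k ≠ 0 ∧ ∀ i, U i 0 = k * v i := by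
  set w : EuclideanSpace ℂ (Fin (n+1)) := WithLp.toLp 2 v with hw
  have hw0 : w ≠ 0 := by
    intro h
    apply hv
    have := congrArg (WithLp.ofLp) h
    simpa [hw] using this
  have hwn : (‖w‖ : ℂ) ≠ 0 := by simpa using hw0
  set e : EuclideanSpace ℂ (Fin (n+1)) := (‖w‖ : ℂ)⁻¹ • w with he
  have hen : ‖e‖ = 1 := by
    rw [he, norm_smul]; simp
    exact inv_mul_cancel₀ (by simpa using hw0)
  have ho : Orthonormal ℂ (({0} : Set (Fin (n+1))).domRestrict (fun _ => e)) := by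
    rw [orthonormal_iff_ite]
    rintro ⟨i, hi⟩ ⟨j, hj⟩
    simp at hi hj
    subst hi hj
    simp only [Set.domRestrict_apply, if_true]
    rw [inner_self_eq_norm_sq_to_K, hen]; simp
  obtain ⟨b, hb⟩ := ho.exists_orthonormalBasis_extension_of_card_eq (ι := Fin (n+1)) (by simp)
  refine ⟨Matrix.of fun i j => b j i, ?_, (‖w‖ : ℂ)⁻¹, inv_ne_zero hwn, ?_⟩
  · ext i j
    have := orthonormal_iff_ite.1 b.orthonormal i j
    rw [Matrix.mul_apply, Matrix.one_apply, ← this]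
    simp [PiLp.inner_apply, mul_comm]
  · intro i
    have := hb 0 (by simp)
    simp [this, he, hw]

open Polynomial in
theorem aux_schur : ∀ (n : ℕ) (l : Fin n → ℂ) (A : Matrix (Fin n) (Fin n) ℂ),
    A.charpoly = ∏ i, (X - C (l i)) →
    ∃ U : Matrix (Fin n) (Fin n) ℂ, Uᴴ * U = 1 ∧ (∀ i j, j < i → (Uᴴ * A * U) i j = 0) ∧
      ∀ i, (Uᴴ * A * U) i i = l i := by
  intro n
  induction n with
  | zero => intro l A _; exact ⟨1, by simp, fun i => i.elim0, fun i => i.elim0⟩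
  | succ n ih =>
    intro l A hA
    have hroot : (A - l 0 • 1).det = 0 := by
      have : A.charpoly.eval (l 0) = 0 := by
        rw [hA, eval_prod]
        exact Finset.prod_eq_zero (Finset.mem_univ 0) (by simp)
      rw [eval_charpoly] at this
      have h2 : A - l 0 • 1 = - (Matrix.scalar (Fin (n+1)) (l 0) - A) := by
        rw [neg_sub]; congr 1; ext i j; simp [Matrix.one_apply, Matrix.diagonal_apply]
      rw [h2, det_neg, this, mul_zero]
    obtain ⟨v, hv, hAv⟩ := Matrix.exists_mulVec_eq_zero_iff.2 hroot
    obtain ⟨U, hU, k, hk, hUv⟩ := aux_unitary_col v hv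
    have hU' : U * Uᴴ = 1 := mul_eq_one_comm.1 hU
    have hAv' : A *ᵥ v = l 0 • v := by
      rw [sub_mulVec, smul_mulVec, one_mulVec, sub_eq_zero] at hAv; exact hAv
    set T := Uᴴ * A * U with hT
    have hT0 : ∀ i, T i 0 = if i = 0 then l 0 else 0 := by
      intro i
      have h1 : ∀ i, (A * U) i 0 = l 0 * U i 0 := by
        intro i
        have := congrFun hAv' i
        simp only [mulVec, dotProduct, Pi.smul_apply, smul_eq_mul] at this
        simp only [Matrix.mul_apply, hUv]
        rw [show l 0 * (k * v i) = k * (l 0 * v i) by ring, ← this, Finset.mul_sum]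
        exact Finset.sum_congr rfl fun _ _ => by ring
      have h2 : T i 0 = l 0 * (Uᴴ * U) i 0 := by
        rw [hT, Matrix.mul_assoc, Matrix.mul_apply, Matrix.mul_apply, Finset.mul_sum]
        exact Finset.sum_congr rfl fun _ _ => by rw [h1]; ring
      rw [h2, hU, Matrix.one_apply]; simp
    set B : Matrix (Fin n) (Fin n) ℂ := T.submatrix Fin.succ Fin.succ with hB
    have hcT : T.charpoly = A.charpoly := by
      have : T = Uᴴ * (A * U) := by rw [hT, Matrix.mul_assoc]
      rw [this, charpoly_mul_comm, Matrix.mul_assoc, hU', mul_one]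
    have hcB : T.charpoly = (X - C (l 0)) * B.charpoly := by
      unfold Matrix.charpoly
      rw [det_succ_column_zero, Finset.sum_eq_single 0]
      · simp [charmatrix_apply, hT0]
        left
        congr 1
        ext i j : 2
        simp [charmatrix_apply, hB, Matrix.diagonal_apply]
      · intro i _ hi
        rw [charmatrix_apply, hT0]; simp [hi]
      · simp
    have hBc : B.charpoly = ∏ i : Fin n, (X - C (l i.succ)) := by
      have : (X - C (l 0)) * B.charpoly = (X - C (l 0)) * ∏ i : Fin n, (X - C (l i.succ)) := by
        rw [← hcB, hcT, hA, Fin.prod_univ_succ]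
      exact mul_left_cancel₀ (X_sub_C_ne_zero _) this
    obtain ⟨V, hV, hV1, hV2⟩ := ih (fun i => l i.succ) B hBc
    set W : Matrix (Fin (n+1)) (Fin (n+1)) ℂ :=
      Matrix.of (Fin.cons (Fin.cons 1 0) (fun i => Fin.cons 0 (V i))) with hW
    have w00 : W 0 0 = 1 := by simp [hW]
    have w0s : ∀ j : Fin n, W 0 j.succ = 0 := by intro j; simp [hW]
    have ws0 : ∀ j : Fin n, W j.succ 0 = 0 := by intro j; simp [hW]
    have wss : ∀ i j : Fin n, W i.succ j.succ = V i j := by intro i j; simp [hW]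
    have key : (U * W)ᴴ * A * (U * W) = Wᴴ * T * W := by
      rw [conjTranspose_mul, hT]; simp only [Matrix.mul_assoc]
    have kss : ∀ i j : Fin n, (Wᴴ * T * W) i.succ j.succ = (Vᴴ * B * V) i j := by
      intro i j
      simp [Matrix.mul_apply, Fin.sum_univ_succ, w0s, wss, hB]
    have ks0 : ∀ i : Fin n, (Wᴴ * T * W) i.succ 0 = 0 := by
      intro i
      simp [Matrix.mul_apply, Fin.sum_univ_succ, w0s, wss, hT0, ws0]
    have k00 : (Wᴴ * T * W) 0 0 = l 0 := by
      simp [Matrix.mul_apply, Fin.sum_univ_succ, w00, hT0, ws0]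
    refine ⟨U * W, ?_, ?_, ?_⟩
    · rw [conjTranspose_mul, Matrix.mul_assoc, ← Matrix.mul_assoc Uᴴ, hU, one_mul]
      ext i j
      refine Fin.cases ?_ (fun i => ?_) i <;> refine Fin.cases ?_ (fun j => ?_) j
      · simp [Matrix.mul_apply, Fin.sum_univ_succ, w00, ws0]
      · simp [Matrix.mul_apply, Fin.sum_univ_succ, w0s, ws0, Matrix.one_apply, (Fin.succ_ne_zero _).symm]
      · simp [Matrix.mul_apply, Fin.sum_univ_succ, w0s, ws0]
      · have := congrFun (congrFun hV i) j
        simp [Matrix.mul_apply, Fin.sum_univ_succ, w0s, wss, Matrix.one_apply] at this ⊢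
        exact this
    · intro i j hij
      rw [key]
      revert hij
      refine Fin.cases ?_ (fun i => ?_) i <;> refine Fin.cases ?_ (fun j => ?_) j
      · simp
      · simp
      · intro _; exact ks0 i
      · intro h; rw [kss]; exact hV1 i j (Fin.succ_lt_succ_iff.1 h)
    · intro i
      rw [key]
      refine Fin.cases ?_ (fun i => ?_) i
      · exact k00
      · rw [kss]; exact hV2 i

/-- explicit contradiction for triangular form -/
theorem aux_det_explicit (c s t : ℂ) (hc : c ≠ 0) (ht : t = 1 - c ^ 2) (ht0 : t ≠ 0) :
    (!![s + 2*c, -1, -1, -1, -1;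
       -1, s / t, 1/c, 1/c, 1/c;
       -1, 1/c, s/(t*c^2), 1/c^3, 1/c^3;
       -1, 1/c, 1/c^3, s/(t*c^4), 1/c^5;
       -1, 1/c, 1/c^3, 1/c^5, s/(t*c^6)] : Matrix (Fin 5) (Fin 5) ℂ).det * (t^4*c^12)
     = (s^2-t^2)*(s^3+2*c*s^2+(t^2-4*t)*s+2*c*t^2) := by
  simp [det_succ_row_zero, Fin.sum_univ_succ, Fin.succAbove]
  field_simp
  subst ht
  ring

theorem aux_tri (T : Matrix (Fin 5) (Fin 5) ℂ) (c s : ℝ) (hc : 0 < c) (hc1 : c < 1) (hs : 0 < s)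
    (hT : T * Tᴴ * T = T) (hlow : ∀ i j, j < i → T i j = 0)
    (hd0 : T 0 0 = 0) (hd : ∀ i : Fin 4, T i.succ i.succ = c)
    (hpsd : ∀ x : Fin 5 → ℂ, 0 ≤ (star x ⬝ᵥ
      (((s : ℂ) • 1 - (T - (c : ℂ) • 1) - (T - (c : ℂ) • 1)ᴴ) *ᵥ x)).re)
    (hdet1 : ((s : ℂ) • 1 - (T - (c : ℂ) • 1) - (T - (c : ℂ) • 1)ᴴ).det = 0)
    (hdet2 : ((-s : ℂ) • 1 - (T - (c : ℂ) • 1) - (T - (c : ℂ) • 1)ᴴ).det = 0) : False := by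
  have hcC : (c : ℂ) ≠ 0 := by exact_mod_cast hc.ne'
  set t : ℝ := 1 - c ^ 2 with ht
  have ht0 : 0 < t := by rw [ht]; nlinarith
  have htC : (t : ℂ) = 1 - (c : ℂ) ^ 2 := by rw [ht]; push_cast; ring
  have htC0 : (t : ℂ) ≠ 0 := by exact_mod_cast ht0.ne'
  have l10 := hlow 1 0 (by decide)
  have l20 := hlow 2 0 (by decide)
  have l21 := hlow 2 1 (by decide)
  have l30 := hlow 3 0 (by decide)
  have l31 := hlow 3 1 (by decide)
  have l32 := hlow 3 2 (by decide)
  have l40 := hlow 4 0 (by decide)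
  have l41 := hlow 4 1 (by decide)
  have l42 := hlow 4 2 (by decide)
  have l43 := hlow 4 3 (by decide)
  have d1 : T 1 1 = c := hd 0
  have d2 : T 2 2 = c := hd 1
  have d3 : T 3 3 = c := hd 2
  have d4 : T 4 4 = c := hd 3
  set Z := Tᴴ * T - 1 with hZ
  have hTZ : T * Z = 0 := by
    rw [hZ, Matrix.mul_sub, ← Matrix.mul_assoc, hT, mul_one, sub_self]
  have z4 : ∀ j, Z 4 j = 0 := by
    intro j
    have := congrFun (congrFun hTZ 4) j
    simpa [Matrix.mul_apply, Fin.sum_univ_five, l40, l41, l42, l43, d4, hcC] using this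
  have z3 : ∀ j, Z 3 j = 0 := by
    intro j
    have := congrFun (congrFun hTZ 3) j
    simpa [Matrix.mul_apply, Fin.sum_univ_five, l30, l31, l32, d3, hcC, z4] using this
  have z2 : ∀ j, Z 2 j = 0 := by
    intro j
    have := congrFun (congrFun hTZ 2) j
    simpa [Matrix.mul_apply, Fin.sum_univ_five, l20, l21, d2, hcC, z4, z3] using this
  have z1 : ∀ j, Z 1 j = 0 := by
    intro j
    have := congrFun (congrFun hTZ 1) j
    simpa [Matrix.mul_apply, Fin.sum_univ_five, l10, d1, hcC, z4, z3, z2] using this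
  have q11 := z1 1
  have q12 := z1 2
  have q13 := z1 3
  have q14 := z1 4
  have q22 := z2 2
  have q23 := z2 3
  have q24 := z2 4
  have q33 := z3 3
  have q34 := z3 4
  have q44 := z4 4
  simp [hZ, Matrix.mul_apply, Fin.sum_univ_five, l10, l20, l30, l40, l21, l31, l41, l32, l42, l43,
    d1, d2, d3, d4] at q11 q12 q13 q14 q22 q23 q24 q33 q34 q44
  clear z1 z2 z3 z4 hTZ hZ
  obtain ⟨b1, hb1⟩ : ∃ b, b = T 0 1 := ⟨_, rfl⟩
  obtain ⟨b2, hb2⟩ : ∃ b, b = T 0 2 := ⟨_, rfl⟩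
  obtain ⟨b3, hb3⟩ : ∃ b, b = T 0 3 := ⟨_, rfl⟩
  obtain ⟨b4, hb4⟩ : ∃ b, b = T 0 4 := ⟨_, rfl⟩
  rw [← hb1] at q11 q12 q13 q14
  rw [← hb2] at q12 q22 q23 q24
  rw [← hb3] at q13 q23 q33 q34
  rw [← hb4] at q14 q24 q34 q44
  set σ := starRingEnd ℂ with hσ
  have hσc : σ (c : ℂ) = c := by simp [hσ]
  have n12 : T 1 2 = - σ b1 * b2 / c := by field_simp; linear_combination q12
  have n13 : T 1 3 = - σ b1 * b3 / c := by field_simp; linear_combination q13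
  have n14 : T 1 4 = - σ b1 * b4 / c := by field_simp; linear_combination q14
  have m1 : σ b1 * b1 = t := by rw [htC]; linear_combination q11
  have c12 : σ (T 1 2) = - b1 * σ b2 / c := by rw [n12]; simp [hσ]
  have c13 : σ (T 1 3) = - b1 * σ b3 / c := by rw [n13]; simp [hσ]
  have c14 : σ (T 1 4) = - b1 * σ b4 / c := by rw [n14]; simp [hσ]
  have m2 : σ b2 * b2 = t * c ^ 2 := by
    rw [c12, n12] at q22; field_simp at q22
    linear_combination q22 - (σ b2 * b2) * m1 + (-c^2 - σ b2 * b2) * htC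
  have n23 : T 2 3 = - σ b2 * b3 / c ^ 3 := by
    rw [c12, n13] at q23; field_simp at q23 ⊢
    linear_combination q23 - (σ b2 * b3) * m1 - σ b2 * b3 * htC
  have n24 : T 2 4 = - σ b2 * b4 / c ^ 3 := by
    rw [c12, n14] at q24; field_simp at q24 ⊢
    linear_combination q24 - (σ b2 * b4) * m1 - σ b2 * b4 * htC
  have c23 : σ (T 2 3) = - b2 * σ b3 / c ^ 3 := by rw [n23]; simp [hσ]
  have c24 : σ (T 2 4) = - b2 * σ b4 / c ^ 3 := by rw [n24]; simp [hσ]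
  have m3 : σ b3 * b3 = t * c ^ 4 := by
    rw [c13, n13, c23, n23] at q33; field_simp at q33
    apply mul_left_cancel₀ (pow_ne_zero 2 hcC)
    linear_combination q33 - (σ b3 * b3) * c^4 * m1 - σ b3 * b3 * m2
      - (c^6 + σ b3 * b3 * (c^4+c^2)) * htC
  have n34 : T 3 4 = - σ b3 * b4 / c ^ 5 := by
    rw [c13, n14, c23, n24] at q34; field_simp at q34 ⊢
    apply mul_left_cancel₀ (pow_ne_zero 2 hcC)
    linear_combination q34 - (σ b3 * b4) * c^4 * m1 - σ b3 * b4 * m2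
      - (σ b3 * b4 * (c^4+c^2)) * htC
  have c34 : σ (T 3 4) = - b3 * σ b4 / c ^ 5 := by rw [n34]; simp [hσ]
  have m4 : σ b4 * b4 = t * c ^ 6 := by
    rw [c14, n14, c24, n24, c34, n34] at q44; field_simp at q44
    apply mul_left_cancel₀ (pow_ne_zero 4 hcC)
    linear_combination q44 - (σ b4 * b4) * c^8 * m1 - σ b4 * b4 * c^4 * m2 - σ b4 * b4 * m3
      - (c^10 + σ b4 * b4 * (c^8+c^6+c^4)) * htC
  set D : Matrix (Fin 5) (Fin 5) ℂ := diagonal ![1, b1, b2, b3, b4] with hD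
  have hH : ∀ a : ℂ, a • 1 - (T - (c : ℂ) • 1) - (T - (c : ℂ) • 1)ᴴ = Dᴴ *
      !![a + 2*c, -1, -1, -1, -1;
       -1, a / t, 1/c, 1/c, 1/c;
       -1, 1/c, a/(t*c^2), 1/c^3, 1/c^3;
       -1, 1/c, 1/c^3, a/(t*c^4), 1/c^5;
       -1, 1/c, 1/c^3, 1/c^5, a/(t*c^6)] * D := by
    intro a
    have k1 : a = σ b1 * (a / t) * b1 := by field_simp; linear_combination -a * m1
    have k2 : a = σ b2 * (a / (t * c ^ 2)) * b2 := by field_simp; linear_combination -a * m2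
    have k3 : a = σ b3 * (a / (t * c ^ 4)) * b3 := by field_simp; linear_combination -a * m3
    have k4 : a = σ b4 * (a / (t * c ^ 6)) * b4 := by field_simp; linear_combination -a * m4
    rw [hD, diagonal_conjTranspose]
    ext i j
    rw [mul_diagonal, diagonal_mul]
    fin_cases i <;> fin_cases j <;>
      simp [← hσ, hd0, d1, d2, d3, d4, l10, l20, l30, l40, l21, l31, l41, l32, l42, l43, ← hb1, ← hb2,
        ← hb3, ← hb4, n12, n13, n14, n23, n24, n34, hσc] <;> first
        | exact k1 | exact k2 | exact k3 | exact k4 | ring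
  have hDdet : D.det ≠ 0 := by
    have e1 : b1 ≠ 0 := by rintro rfl; simp at m1; exact htC0 m1.symm
    have e2 : b2 ≠ 0 := by rintro rfl; simp [htC0, hcC] at m2
    have e3 : b3 ≠ 0 := by rintro rfl; simp [htC0, hcC] at m3
    have e4 : b4 ≠ 0 := by rintro rfl; simp [htC0, hcC] at m4
    rw [hD, det_diagonal]
    simp [Fin.prod_univ_five, e1, e2, e3, e4]
  have hDdet' : Dᴴ.det ≠ 0 := by rw [det_conjTranspose]; simpa using hDdet
  have hst : s = t := by
    rw [hH, det_mul, det_mul] at hdet1 hdet2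
    have g1 := aux_det_explicit c s t hcC htC htC0
    have g2 := aux_det_explicit c (-s) t hcC htC htC0
    simp only [mul_eq_zero, hDdet, hDdet', false_or, or_false] at hdet1 hdet2
    rw [hdet1, zero_mul] at g1
    rw [hdet2, zero_mul] at g2
    have g3 : ((s^2-t^2)*(c * (s^2 + t^2)) : ℂ) = 0 := by linear_combination -(g1 + g2)/4
    have g4 : (s^2-t^2)*(c * (s^2 + t^2)) = 0 := by exact_mod_cast g3
    have g5 : s^2 + t^2 ≠ 0 := by positivity
    have g6 : s^2 - t^2 = 0 := by simpa [hc.ne', g5] using g4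
    nlinarith
  have hx := hpsd ![0, 1/b1, -2*(c:ℂ)/b2, (c:ℂ)^2/b3, 0]
  have e1 : b1 ≠ 0 := by rintro rfl; simp at m1; exact htC0 m1.symm
  have e2 : b2 ≠ 0 := by rintro rfl; simp [htC0, hcC] at m2
  have e3 : b3 ≠ 0 := by rintro rfl; simp [htC0, hcC] at m3
  have hDx : D *ᵥ ![0, 1/b1, -2*(c:ℂ)/b2, (c:ℂ)^2/b3, 0] = ![0, 1, -2*(c:ℂ), (c:ℂ)^2, 0] := by
    rw [hD]; ext i; rw [mulVec_diagonal]
    fin_cases i <;> simp <;> field_simp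
  rw [hH, ← mulVec_mulVec, ← mulVec_mulVec, dotProduct_mulVec, ← star_mulVec, hDx, hst] at hx
  have hval : star ![0, 1, -2*(c:ℂ), (c:ℂ)^2, 0] ⬝ᵥ (!![(t:ℂ) + 2*c, -1, -1, -1, -1;
       -1, t / t, 1/c, 1/c, 1/c;
       -1, 1/c, t/(t*c^2), 1/c^3, 1/c^3;
       -1, 1/c, 1/c^3, t/(t*c^4), 1/c^5;
       -1, 1/c, 1/c^3, 1/c^5, t/(t*c^6)] *ᵥ ![0, 1, -2*(c:ℂ), (c:ℂ)^2, 0]) = ((-2 + 2 * c : ℝ) : ℂ) := by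
    simp [mulVec, dotProduct, Fin.sum_univ_five]
    field_simp
    ring
  rw [hval, Complex.ofReal_re] at hx
  linarith

theorem aux_form (A : Matrix (Fin 5) (Fin 5) ℂ) (c r : ℝ) (w : ℂ) (x : Fin 5 → ℂ) :
    star x ⬝ᵥ (((2 * r : ℂ) • 1 - w • (A - (c : ℂ) • 1) - star w • (A - (c : ℂ) • 1)ᴴ) *ᵥ x)
     = 2 * r * (star x ⬝ᵥ x) - w * (star x ⬝ᵥ A *ᵥ x - c * (star x ⬝ᵥ x))
        - star (w * (star x ⬝ᵥ A *ᵥ x - c * (star x ⬝ᵥ x))) := by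
  have h1 : star x ⬝ᵥ (A - (c : ℂ) • 1)ᴴ *ᵥ x = star (star x ⬝ᵥ (A - (c : ℂ) • 1) *ᵥ x) := by
    rw [dotProduct_mulVec, ← star_mulVec, star_dotProduct]
  have h2 : star x ⬝ᵥ (A - (c : ℂ) • 1) *ᵥ x = star x ⬝ᵥ A *ᵥ x - c * (star x ⬝ᵥ x) := by
    simp only [sub_mulVec, smul_mulVec, dotProduct_sub, dotProduct_smul, one_mulVec, smul_eq_mul]
  rw [sub_mulVec, sub_mulVec, smul_mulVec, smul_mulVec, smul_mulVec, dotProduct_sub, dotProduct_sub,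
    dotProduct_smul, dotProduct_smul, dotProduct_smul, h1, h2, one_mulVec, star_mul']
  simp only [smul_eq_mul]

open ComplexOrder in
theorem aux_psd (A : Matrix (Fin 5) (Fin 5) ℂ) (c r : ℝ)
    (hb : ∀ x : Fin 5 → ℂ, ‖star x ⬝ᵥ A *ᵥ x - c * (star x ⬝ᵥ x)‖ ≤ r * (star x ⬝ᵥ x).re)
    (w : ℂ) (hw : ‖w‖ = 1) :
    ((2 * r : ℂ) • 1 - w • (A - (c : ℂ) • 1) - star w • (A - (c : ℂ) • 1)ᴴ).PosSemidef := by
  refine Matrix.PosSemidef.of_dotProduct_mulVec_nonneg ?_ ?_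
  · rw [Matrix.IsHermitian]
    simp only [conjTranspose_sub, conjTranspose_smul, conjTranspose_conjTranspose, conjTranspose_one,
      star_star]
    simp
    abel
  · intro x
    have hx0 : 0 ≤ star x ⬝ᵥ x := dotProduct_star_self_nonneg x
    have h3 := hb x
    rw [aux_form]
    set z := star x ⬝ᵥ A *ᵥ x - c * (star x ⬝ᵥ x)
    have h4 : (w * z).re ≤ r * (star x ⬝ᵥ x).re := by
      refine le_trans (Complex.re_le_norm _) ?_
      rwa [norm_mul, hw, one_mul]
    rw [Complex.le_def] at hx0 ⊢
    obtain ⟨_, h6⟩ := hx0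
    simp only [Complex.zero_re, Complex.zero_im] at *
    constructor
    · simp [Complex.mul_re, ← h6] at h4 ⊢
      linarith
    · simp [← h6]
      ring

open ComplexOrder in
theorem aux_det_zero (A : Matrix (Fin 5) (Fin 5) ℂ) (c r : ℝ)
    (hb : ∀ x : Fin 5 → ℂ, ‖star x ⬝ᵥ A *ᵥ x - c * (star x ⬝ᵥ x)‖ ≤ r * (star x ⬝ᵥ x).re)
    (he : ∀ w : ℂ, ‖w‖ = 1 → ∃ x : Fin 5 → ℂ, star x ⬝ᵥ x = 1 ∧ star x ⬝ᵥ A *ᵥ x = c + r * w)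
    (w : ℂ) (hw : ‖w‖ = 1) :
    ((2 * r : ℂ) • 1 - w • (A - (c : ℂ) • 1) - star w • (A - (c : ℂ) • 1)ᴴ).det = 0 := by
  have hP := aux_psd A c r hb w hw
  obtain ⟨x, hx1, hx2⟩ := he (star w) (by simpa using hw)
  have hww : w * star w = 1 := by
    have := Complex.mul_conj w
    rw [Complex.normSq_eq_norm_sq, hw] at this
    simpa using this
  have hz : star x ⬝ᵥ (((2 * r : ℂ) • 1 - w • (A - (c : ℂ) • 1) - star w • (A - (c : ℂ) • 1)ᴴ) *ᵥ x) = 0 := by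
    rw [aux_form, hx1, hx2]
    have : w * (↑c + ↑r * star w - ↑c * 1) = r := by linear_combination r * hww
    rw [this]
    simp
    ring
  rw [hP.dotProduct_mulVec_zero_iff] at hz
  refine Matrix.exists_mulVec_eq_zero_iff.mp ⟨x, ?_, hz⟩
  rintro rfl
  simp at hx1

open Polynomial in
theorem aux_poly_zero (A : Matrix (Fin 5) (Fin 5) ℂ) (c r : ℝ) (hr : 0 < r)
    (hdet : ∀ w : ℂ, ‖w‖ = 1 →
      ((2 * r : ℂ) • 1 - w • (A - (c : ℂ) • 1) - star w • (A - (c : ℂ) • 1)ᴴ).det = 0) :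
    ((A.map C - (C (c : ℂ) + X : ℂ[X]) • (1 : Matrix (Fin 5) (Fin 5) ℂ[X])) + (C (1 / (2 * r : ℂ) ^ 2) * X ^ 2 : ℂ[X]) •
      (Aᴴ.map C - C (c : ℂ) • (1 : Matrix (Fin 5) (Fin 5) ℂ[X]))).det = 0 := by
  apply Polynomial.eq_zero_of_infinite_isRoot
  have hinf : (Metric.sphere (0 : ℂ) (2 * r)).Infinite := by
    apply IsPreconnected.infinite_of_nontrivial
    · apply isPreconnected_sphere
      rw [Complex.rank_real_complex]; norm_num
    · refine ⟨(2 * r : ℂ), ?_, -(2 * r : ℂ), ?_, ?_⟩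
      · simp [abs_of_pos hr]
      · simp [abs_of_pos hr]
      · have : (r : ℂ) ≠ 0 := by exact_mod_cast hr.ne'
        intro h
        apply this
        linear_combination h / 4
  refine hinf.mono ?_
  intro a ha
  rw [mem_sphere_zero_iff_norm] at ha
  have hrC : (r : ℂ) ≠ 0 := by exact_mod_cast hr.ne'
  have ha' : a * star a = (2 * r) ^ 2 := by
    have := Complex.mul_conj a
    rw [Complex.normSq_eq_norm_sq, ha] at this
    simpa using this
  have ha0 : a ≠ 0 := by rintro rfl; simp at ha; linarith
  have h1 := hdet (star a / (2 * r)) (by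
    rw [norm_div, norm_star, ha]; simp [abs_of_pos hr, hr.ne'])
  change Polynomial.eval a _ = 0
  rw [← Polynomial.coe_evalRingHom, RingHom.map_det]
  have h2 : (evalRingHom a).mapMatrix ((A.map C - (C (c : ℂ) + X : ℂ[X]) • (1 : Matrix (Fin 5) (Fin 5) ℂ[X])) + (C (1 / (2 * r : ℂ) ^ 2) * X ^ 2 : ℂ[X]) •
      (Aᴴ.map C - C (c : ℂ) • (1 : Matrix (Fin 5) (Fin 5) ℂ[X]))) =
      (-(a / (2 * r))) • ((2 * r : ℂ) • 1 - (star a / (2 * r)) • (A - (c : ℂ) • 1) - star (star a / (2 * r)) • (A - (c : ℂ) • 1)ᴴ) := by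
    have hs : star (star a / (2 * r) : ℂ) = a / (2 * r) := by simp
    rw [hs]
    have hinv : (a / (2 * r)) * (star a / (2 * r)) = 1 := by
      field_simp; linear_combination ha'
    have hc2 : (c : ℂ) = star (c : ℂ) := by simp
    rw [conjTranspose_sub, conjTranspose_smul, ← hc2, conjTranspose_one]
    ext i j
    have e1 : (evalRingHom a) ((1 : Matrix (Fin 5) (Fin 5) ℂ[X]) i j) = (1 : Matrix (Fin 5) (Fin 5) ℂ) i j := by
      by_cases h : i = j
      · subst h; simp
      · simp [Matrix.one_apply_ne h]
    simp only [RingHom.mapMatrix_apply, Matrix.map_apply, Matrix.add_apply, Matrix.sub_apply,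
      Matrix.smul_apply, smul_eq_mul, map_add, map_sub, map_mul, e1, map_pow]
    simp only [coe_evalRingHom, eval_C, eval_X]
    have e3 : a / (2 * r) * (2 * r) = a := by field_simp
    have e4 : 1 / (2 * r : ℂ) ^ 2 * a ^ 2 = (a / (2*r)) * (a / (2*r)) := by field_simp
    rw [e4]
    linear_combination ((-(A i j) + c * (1 : Matrix (Fin 5) (Fin 5) ℂ) i j)) * hinv + (1 : Matrix (Fin 5) (Fin 5) ℂ) i j * e3
  rw [h2, det_smul, h1, mul_zero]

open ComplexOrder in
theorem aux_AAA (A : Matrix (Fin 5) (Fin 5) ℂ) (hpi : (Aᴴ * A) * (Aᴴ * A) = Aᴴ * A) :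
    A * Aᴴ * A = A := by
  have h : (A * Aᴴ * A - A)ᴴ * (A * Aᴴ * A - A) = 0 := by
    have e1 : (A * Aᴴ * A - A)ᴴ * (A * Aᴴ * A - A) =
      (Aᴴ * A) * (Aᴴ * A) * (Aᴴ * A) - (Aᴴ * A) * (Aᴴ * A) - (Aᴴ * A) * (Aᴴ * A) + Aᴴ * A := by
      simp only [conjTranspose_sub, conjTranspose_mul, conjTranspose_conjTranspose]
      noncomm_ring
    rw [e1, hpi, hpi]; abel
  exact sub_eq_zero.mp (Matrix.conjTranspose_mul_self_eq_zero.mp h)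

/-- contraction -/
theorem aux_contr (A : Matrix (Fin 5) (Fin 5) ℂ) (hpi : (Aᴴ * A) * (Aᴴ * A) = Aᴴ * A)
    (x : Fin 5 → ℂ) : (star (A *ᵥ x) ⬝ᵥ (A *ᵥ x)).re ≤ (star x ⬝ᵥ x).re := by
  set P := 1 - Aᴴ * A with hP
  have h1 : Pᴴ = P := by simp [hP]
  have h2 : P * P = P := by
    rw [hP, sub_mul, mul_sub, mul_sub, hpi]; simp
  have h3 : star (P *ᵥ x) ⬝ᵥ (P *ᵥ x) = star x ⬝ᵥ x - star (A *ᵥ x) ⬝ᵥ (A *ᵥ x) := by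
    rw [star_mulVec, ← dotProduct_mulVec, h1, mulVec_mulVec, h2, star_mulVec, ← dotProduct_mulVec,
      mulVec_mulVec, hP, sub_mulVec, one_mulVec, dotProduct_sub]
  have h4 : 0 ≤ (star (P *ᵥ x) ⬝ᵥ (P *ᵥ x)).re := by
    simp only [dotProduct, Complex.re_sum]
    refine Finset.sum_nonneg fun i _ => ?_
    simp [Complex.mul_re]
    nlinarith [sq_nonneg ((P *ᵥ x) i).re, sq_nonneg ((P *ᵥ x) i).im]
  rw [h3, Complex.sub_re] at h4
  linarith

theorem aux_cr (A : Matrix (Fin 5) (Fin 5) ℂ) (hpi : (Aᴴ * A) * (Aᴴ * A) = Aᴴ * A)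
    (c r : ℝ) (x : Fin 5 → ℂ) (hx : star x ⬝ᵥ x = 1) (hx2 : star x ⬝ᵥ A *ᵥ x = c + r) :
    c + r ≤ 1 := by
  have h1 := aux_contr A hpi x
  have h4 : 0 ≤ (star (x - A *ᵥ x) ⬝ᵥ (x - A *ᵥ x)).re := by
    simp only [dotProduct, Complex.re_sum]
    refine Finset.sum_nonneg fun i _ => ?_
    simp [Complex.mul_re]
    nlinarith [sq_nonneg ((x i).re - ((A *ᵥ x) i).re), sq_nonneg ((x i).im - ((A *ᵥ x) i).im)]
  have h5 : star (A *ᵥ x) ⬝ᵥ x = star (star x ⬝ᵥ A *ᵥ x) := star_dotProduct _ _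
  rw [star_sub, sub_dotProduct, dotProduct_sub, dotProduct_sub, h5, hx2, hx] at h4
  rw [hx] at h1
  simp at h4 h1
  linarith

open ComplexOrder in
theorem aux_det_A (A : Matrix (Fin 5) (Fin 5) ℂ) (hpi : (Aᴴ * A) * (Aᴴ * A) = Aᴴ * A)
    (c : ℝ) (hc : 0 < c) (hc1 : c < 1) (hdet : (A - (c : ℂ) • 1).det = 0) : A.det = 0 := by
  by_contra h
  have hu : IsUnit (Aᴴ * A) := by
    rw [Matrix.isUnit_iff_isUnit_det, det_mul, det_conjTranspose]
    simp [h]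
  have h1 : Aᴴ * A = 1 := hu.mul_left_cancel (by rw [hpi, mul_one])
  obtain ⟨x, hx0, hx⟩ := Matrix.exists_mulVec_eq_zero_iff.mpr hdet
  rw [sub_mulVec, sub_eq_zero, smul_mulVec, one_mulVec] at hx
  have h2 : star (A *ᵥ x) ⬝ᵥ (A *ᵥ x) = star x ⬝ᵥ x := by
    rw [star_mulVec, ← dotProduct_mulVec, mulVec_mulVec, h1, one_mulVec]
  rw [hx, star_smul, smul_dotProduct, dotProduct_smul] at h2
  have h3 : star x ⬝ᵥ x ≠ 0 := by
    intro h; exact hx0 (dotProduct_star_self_eq_zero.mp h)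
  have h4 : (c : ℂ) * c = 1 := by
    apply mul_right_cancel₀ h3
    simp at h2
    linear_combination h2
  have h5 : c * c = 1 := by exact_mod_cast h4
  nlinarith

open Polynomial in
theorem aux_charpoly (A : Matrix (Fin 5) (Fin 5) ℂ) (c : ℂ) (hc : c ≠ 0) (hA : A.det = 0)
    (hX : (X : ℂ[X]) ^ 4 ∣ (A.map C - (C c + X : ℂ[X]) • (1 : Matrix (Fin 5) (Fin 5) ℂ[X])).det) :
    A.charpoly = X * (X - C c) ^ 4 := by
  have h1 : (compRingHom (X - C c : ℂ[X]))
      (A.map C - (C c + X : ℂ[X]) • (1 : Matrix (Fin 5) (Fin 5) ℂ[X])).det = - A.charpoly := by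
    rw [RingHom.map_det, Matrix.charpoly]
    have : (compRingHom (X - C c : ℂ[X])).mapMatrix
        (A.map C - (C c + X : ℂ[X]) • (1 : Matrix (Fin 5) (Fin 5) ℂ[X])) = - charmatrix A := by
      ext1 i j
      by_cases h : i = j
      · subst h; simp [charmatrix_apply_eq]
      · simp [Matrix.one_apply_ne h, charmatrix_apply_ne _ _ _ h]
    rw [this, det_neg, Fintype.card_fin]
    ring
  have h2 : (X - C c : ℂ[X]) ^ 4 ∣ A.charpoly := by
    rw [← dvd_neg, ← h1]
    have := map_dvd (compRingHom (X - C c : ℂ[X])) hX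
    simpa using this
  have h3 : (X : ℂ[X]) ∣ A.charpoly := by
    rw [X_dvd_iff, coeff_zero_eq_eval_zero, Matrix.eval_charpoly]
    simp [det_neg, hA]
  have h4 : IsCoprime (X : ℂ[X]) ((X - C c) ^ 4) := by
    apply IsCoprime.pow_right
    have := isCoprime_X_sub_C_of_isUnit_sub (R := ℂ) (a := 0) (b := c) (by simpa using hc)
    simpa using this
  have h5 := h4.mul_dvd h3 h2
  have hm : (X * (X - C c) ^ 4 : ℂ[X]).Monic := monic_X.mul ((monic_X_sub_C c).pow 4)
  refine (eq_of_monic_of_dvd_of_natDegree_le hm (Matrix.charpoly_monic A) h5 ?_)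
  rw [Matrix.charpoly_natDegree_eq_dim, Monic.natDegree_mul monic_X ((monic_X_sub_C c).pow 4)]
  simp
open Polynomial in
theorem aux_main (A : Matrix (Fin 5) (Fin 5) ℂ) (hpi : (Aᴴ * A) * (Aᴴ * A) = Aᴴ * A)
    (c r : ℝ) (hc : 0 < c) (hr : 0 < r)
    (hb : ∀ x : Fin 5 → ℂ, ‖star x ⬝ᵥ A *ᵥ x - c * (star x ⬝ᵥ x)‖ ≤ r * (star x ⬝ᵥ x).re)
    (he : ∀ w : ℂ, ‖w‖ = 1 → ∃ x : Fin 5 → ℂ, star x ⬝ᵥ x = 1 ∧ star x ⬝ᵥ A *ᵥ x = c + r * w) :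
    False := by
  have hcC : (c : ℂ) ≠ 0 := by exact_mod_cast hc.ne'
  have hAAA := aux_AAA A hpi
  have hdz := aux_det_zero A c r hb he
  have hpz := aux_poly_zero A c r hr hdz
  obtain ⟨q, hq⟩ := aux_det_expand
    (A.map C - (C (c : ℂ) + X : ℂ[X]) • (1 : Matrix (Fin 5) (Fin 5) ℂ[X]))
    (Aᴴ.map C - C (c : ℂ) • (1 : Matrix (Fin 5) (Fin 5) ℂ[X])) (C (1 / (2 * r : ℂ) ^ 2) * X ^ 2 : ℂ[X])
  rw [hpz] at hq
  obtain ⟨u, v, huv⟩ := aux_struct A hAAA (c : ℂ)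
  have hX := aux_dvd_step _ _ (C (1 / (2 * r : ℂ) ^ 2) ^ 2 * q) u v c (1 / (2 * r : ℂ) ^ 2) hcC huv
    (by rw [hq]; ring)
  have hc1 : c < 1 := by
    obtain ⟨x, hx1, hx2⟩ := he 1 (by simp)
    have := aux_cr A hpi c r x hx1 (by rw [hx2, mul_one])
    linarith
  have hAc : (A - (c : ℂ) • 1).det = 0 := by
    obtain ⟨g, hg⟩ := hX
    have h1 := congrArg (evalRingHom (0 : ℂ)) hg
    rw [RingHom.map_det] at h1
    have h2 : (evalRingHom (0 : ℂ)).mapMatrix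
        (A.map C - (C (c : ℂ) + X : ℂ[X]) • (1 : Matrix (Fin 5) (Fin 5) ℂ[X])) = A - (c : ℂ) • 1 := by
      ext i j
      by_cases h : i = j
      · subst h; simp
      · simp [Matrix.one_apply_ne h]
    rw [h2] at h1
    rw [h1]; simp
  have hA0 := aux_det_A A hpi c hc hc1 hAc
  have hchar := aux_charpoly A c hcC hA0 hX
  obtain ⟨U, hU, hlow, hdiag⟩ := aux_schur 5 ![0, (c : ℂ), c, c, c] A (by
    rw [hchar]; simp [Fin.prod_univ_five]; ring)
  have hU2 : U * Uᴴ = 1 := mul_eq_one_comm.mp hU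
  have hconj : (Uᴴ * A * U)ᴴ = Uᴴ * Aᴴ * U := by
    simp [Matrix.mul_assoc]
  have hconj2 : ∀ a w : ℂ, a • 1 - w • (Uᴴ * A * U - (c : ℂ) • 1) - star w • (Uᴴ * A * U - (c : ℂ) • 1)ᴴ
      = Uᴴ * (a • 1 - w • (A - (c : ℂ) • 1) - star w • (A - (c : ℂ) • 1)ᴴ) * U := by
    intro a w
    simp only [conjTranspose_sub, hconj, mul_sub, sub_mul, conjTranspose_smul, conjTranspose_one,
      mul_smul_comm, smul_mul_assoc, mul_one, hU]
  have hdetU : ∀ M : Matrix (Fin 5) (Fin 5) ℂ, M.det = 0 → (Uᴴ * M * U).det = 0 := by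
    intro M hM; rw [det_mul, det_mul, hM]; simp
  refine aux_tri (Uᴴ * A * U) c (2 * r) hc hc1 (by positivity) ?_ hlow (hdiag 0) ?_ ?_ ?_ ?_
  · rw [hconj]
    calc _ = Uᴴ * (A * (U * Uᴴ) * Aᴴ * (U * Uᴴ) * A) * U := by simp only [Matrix.mul_assoc]
      _ = _ := by rw [hU2, mul_one, mul_one, hAAA]
  · intro i; rw [hdiag]; fin_cases i <;> rfl
  · intro x
    have h1 := hconj2 ((2 * r : ℝ) : ℂ) 1
    have h2 := aux_psd A c r hb 1 (by simp)
    simp only [star_one, one_smul] at h1 h2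
    rw [h1, ← mulVec_mulVec, ← mulVec_mulVec, dotProduct_mulVec, ← star_mulVec]
    have h3 := (open ComplexOrder in h2.dotProduct_mulVec_nonneg) (U *ᵥ x)
    push_cast
    exact (Complex.le_def.mp h3).1
  · have h1 := hconj2 ((2 * r : ℝ) : ℂ) 1
    have h2 := hdz 1 (by simp)
    simp only [star_one, one_smul] at h1 h2
    rw [h1]
    apply hdetU
    push_cast
    exact h2
  · have h1 := hconj2 (-((2 * r : ℝ) : ℂ)) 1
    have h2 := hdz (-1) (by simp)
    simp only [star_one, one_smul] at h1
    rw [h1]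
    apply hdetU
    rw [← neg_eq_zero]
    have h3 : (-(((2 * r : ℝ) : ℂ))) • (1 : Matrix (Fin 5) (Fin 5) ℂ) - (A - (c : ℂ) • 1) - (A - (c : ℂ) • 1)ᴴ
      = - ((2 * r : ℂ) • 1 - (-1 : ℂ) • (A - (c : ℂ) • 1) - star (-1 : ℂ) • (A - (c : ℂ) • 1)ᴴ) := by
      simp only [star_neg, star_one, neg_smul, one_smul]
      push_cast
      abel
    rw [h3, det_neg, h2]
    simp

theorem gww_five_by_five
    (A : Matrix (Fin 5) (Fin 5) ℂ)
    (hpi : (Aᴴ * A) * (Aᴴ * A) = Aᴴ * A)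
    (c : ℂ) (r : ℝ) (hr : 0 < r)
    (hW : {w : ℂ | ∃ x : EuclideanSpace ℂ (Fin 5),
        ‖x‖ = 1 ∧ star (x : Fin 5 → ℂ) ⬝ᵥ A.mulVec x = w}
      = Metric.closedBall c r) :
    c = 0 := by
  by_contra hc0
  have hn : 0 < ‖c‖ := norm_pos_iff.mpr hc0
  have hnC : (‖c‖ : ℂ) ≠ 0 := by exact_mod_cast hn.ne'
  set u : ℂ := c / ‖c‖ with hu
  have hu1 : ‖u‖ = 1 := by rw [hu, norm_div]; simp [hc0]
  have hcu : c = ‖c‖ * u := by rw [hu]; field_simp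
  have huu : star u * u = 1 := by
    have := Complex.mul_conj u
    rw [Complex.normSq_eq_norm_sq, hu1] at this
    rw [mul_comm]
    simpa using this
  have hform : ∀ x : Fin 5 → ℂ, star x ⬝ᵥ (star u • A) *ᵥ x = star u * (star x ⬝ᵥ A *ᵥ x) := by
    intro x; rw [smul_mulVec, dotProduct_smul, smul_eq_mul]
  have hnorm : ∀ x : EuclideanSpace ℂ (Fin 5), star (x : Fin 5 → ℂ) ⬝ᵥ (x : Fin 5 → ℂ) = ((‖x‖ ^ 2 : ℝ) : ℂ) := by
    intro x
    have := inner_self_eq_norm_sq_to_K (𝕜 := ℂ) x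
    rw [EuclideanSpace.inner_eq_star_dotProduct, dotProduct_comm] at this
    rw [this]; push_cast; rfl
  refine aux_main (star u • A) ?_ ‖c‖ r hn hr ?_ ?_
  · have : (star u • A)ᴴ * (star u • A) = Aᴴ * A := by
      rw [conjTranspose_smul, star_star, smul_mul_smul_comm, mul_comm, huu, one_smul]
    rw [this, hpi]
  · intro x
    rw [hform]
    have hnx := hnorm (WithLp.toLp 2 x)
    simp only at hnx
    by_cases hx : x = 0
    · subst hx; simp
    set y : EuclideanSpace ℂ (Fin 5) := WithLp.toLp 2 x with hy
    have hy0 : 0 < ‖y‖ := by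
      rw [norm_pos_iff]; intro h; apply hx
      have := congrArg WithLp.ofLp h
      simpa [hy] using this
    have hyC : (‖y‖ : ℂ) ≠ 0 := by exact_mod_cast hy0.ne'
    have hmem : star (((‖y‖⁻¹ : ℂ) • y : EuclideanSpace ℂ (Fin 5)) : Fin 5 → ℂ) ⬝ᵥ A.mulVec ((‖y‖⁻¹ : ℂ) • y : EuclideanSpace ℂ (Fin 5)) ∈ Metric.closedBall c r := by
      rw [← hW]
      exact ⟨_, by rw [norm_smul]; simp [hy0.ne'], rfl⟩
    have h1 : star (((‖y‖⁻¹ : ℂ) • y : EuclideanSpace ℂ (Fin 5)) : Fin 5 → ℂ) ⬝ᵥ A.mulVec ((‖y‖⁻¹ : ℂ) • y : EuclideanSpace ℂ (Fin 5))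
        = (‖y‖⁻¹ : ℂ) ^ 2 * (star x ⬝ᵥ A *ᵥ x) := by
      rw [WithLp.ofLp_smul, star_smul, mulVec_smul, smul_dotProduct, dotProduct_smul]
      simp [hy]
      ring
    rw [h1, mem_closedBall_iff_norm] at hmem
    rw [hnx, Complex.ofReal_re]
    have h2 : star u * (star x ⬝ᵥ A *ᵥ x) - ‖c‖ * ((‖y‖ ^ 2 : ℝ) : ℂ)
        = star u * ((‖y‖ : ℂ) ^ 2 * ((‖y‖⁻¹ : ℂ) ^ 2 * (star x ⬝ᵥ A *ᵥ x) - c)) := by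
      have e : (‖y‖ : ℂ) ^ 2 * (‖y‖⁻¹ : ℂ) ^ 2 = 1 := by field_simp
      push_cast
      linear_combination (-star u * (star x ⬝ᵥ A *ᵥ x)) * e + star u * ‖y‖ ^ 2 * hcu + ‖c‖ * ‖y‖ ^ 2 * huu
    rw [h2, norm_mul, norm_star, hu1, one_mul, norm_mul, norm_pow, Complex.norm_real, norm_norm, mul_comm]
    gcongr
  · intro w hw
    have hmem : c + r * (u * w) ∈ Metric.closedBall c r := by
      rw [mem_closedBall_iff_norm]
      simp [hu1, hw, abs_of_pos hr]
    rw [← hW] at hmem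
    obtain ⟨x, hx1, hx2⟩ := hmem
    refine ⟨x, by rw [hnorm, hx1]; simp, ?_⟩
    rw [hform, hx2]
    linear_combination star u * hcu + (‖c‖ + r * w) * huu
end
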